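/- Let Γ = (G, I, O, λ) be a labelled open graph that admits a focussed Pauli flow. Then |I| ≤ |O| and Γ has exactly 2^{|O|−|I|} distinct focussed sets. -/

import Mathlib

open scoped symmDiff

inductive MeasLabel : Type
  | XY | XZ | YZ | X | Y | Z
deriving DecidableEq

/-- A labelled open graph: a finite simple graph with input and output sets and a
measurement labelling (only its values on non-outputs are ever used). -/
structure LOG (V : Type) [Fintype V] where
  G : SimpleGraph V
  I : Set V
  O : Set V
  lam : V → MeasLabel

namespace LOG

variable {V : Type} [Fintype V]

/-- The odd neighbourhood of `A`: vertices with an odd number of neighbours in `A`. -/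
def odd (G : SimpleGraph V) (A : Set V) : Set V :=
  {w | Odd ((G.neighborSet w ∩ A).ncard)}

/-- `v` is a measured (non-output) vertex whose label lies in `s`.  (The labelling of a
labelled open graph is only defined on non-outputs.) -/
def labIn (Γ : LOG V) (v : V) (s : Set MeasLabel) : Prop :=
  v ∉ Γ.O ∧ Γ.lam v ∈ s

/-- The Pauli flow conditions for a map `p` and a strict partial order `prec` (`≺`). -/
structure IsPauliFlow (Γ : LOG V) (p : V → Set V) (prec : V → V → Prop) : Prop where
  irrefl : ∀ a, ¬ prec a a
  trans : ∀ a b c, prec a b → prec b c → prec a c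
  psub : ∀ u, u ∉ Γ.O → ∀ v ∈ p u, v ∉ Γ.I
  pf1 : ∀ u, u ∉ Γ.O → ∀ v ∈ p u, u ≠ v →
    ¬ Γ.labIn v {MeasLabel.X, MeasLabel.Y} → prec u v
  pf2 : ∀ u, u ∉ Γ.O → ∀ v ∈ odd Γ.G (p u), u ≠ v →
    ¬ Γ.labIn v {MeasLabel.Y, MeasLabel.Z} → prec u v
  pf3 : ∀ u, u ∉ Γ.O → ∀ v, ¬ prec u v → u ≠ v →
    Γ.labIn v {MeasLabel.Y} → (v ∈ p u ↔ v ∈ odd Γ.G (p u))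
  pf4 : ∀ u, u ∉ Γ.O → Γ.lam u = MeasLabel.XY → u ∉ p u ∧ u ∈ odd Γ.G (p u)
  pf5 : ∀ u, u ∉ Γ.O → Γ.lam u = MeasLabel.XZ → u ∈ p u ∧ u ∈ odd Γ.G (p u)
  pf6 : ∀ u, u ∉ Γ.O → Γ.lam u = MeasLabel.YZ → u ∈ p u ∧ u ∉ odd Γ.G (p u)
  pf7 : ∀ u, u ∉ Γ.O → Γ.lam u = MeasLabel.X → u ∈ odd Γ.G (p u)
  pf8 : ∀ u, u ∉ Γ.O → Γ.lam u = MeasLabel.Z → u ∈ p u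
  pf9 : ∀ u, u ∉ Γ.O → Γ.lam u = MeasLabel.Y →
    ((u ∈ p u ∧ u ∉ odd Γ.G (p u)) ∨ (u ∉ p u ∧ u ∈ odd Γ.G (p u)))

/-- `phat` is focussed over `S`. -/
def FocussedOver (Γ : LOG V) (phat S : Set V) : Prop :=
  (∀ w ∈ S ∩ phat, Γ.lam w ∈ ({MeasLabel.XY, MeasLabel.X, MeasLabel.Y} : Set MeasLabel)) ∧
  (∀ w ∈ S ∩ odd Γ.G phat,
    Γ.lam w ∈ ({MeasLabel.XZ, MeasLabel.YZ, MeasLabel.Y, MeasLabel.Z} : Set MeasLabel)) ∧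
  (∀ w ∈ S, Γ.lam w = MeasLabel.Y → (w ∈ phat ↔ w ∈ odd Γ.G phat))

/-- A focussed set for `Γ`: a subset of the non-inputs that is focussed over all
non-outputs. -/
def IsFocussedSet (Γ : LOG V) (phat : Set V) : Prop :=
  (∀ v ∈ phat, v ∉ Γ.I) ∧ FocussedOver Γ phat {v | v ∉ Γ.O}

/-- A Pauli flow map `p` is focussed if each `p v` is focussed over the measured
vertices other than `v`. -/
def IsFocussed (Γ : LOG V) (p : V → Set V) : Prop :=
  ∀ v, v ∉ Γ.O → FocussedOver Γ (p v) ({w | w ∉ Γ.O} \ {v})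

/-- `Vcum prec k` is `V_{∪k}^≺`, the union of the layers up to depth `k`. -/
def Vcum (prec : V → V → Prop) : ℕ → Set V
  | 0 => {v | ∀ w, ¬ prec v w}
  | k + 1 => Vcum prec k ∪ {v | v ∉ Vcum prec k ∧ ∀ w, w ∉ Vcum prec k → ¬ prec v w}

/-- `Vlayer prec k` is `V_k^≺`, the `≺`-maximal elements among the vertices not of
smaller depth. -/
def Vlayer (prec : V → V → Prop) : ℕ → Set V
  | 0 => {v | ∀ w, ¬ prec v w}
  | k + 1 => {v | v ∉ Vcum prec k ∧ ∀ w, w ∉ Vcum prec k → ¬ prec v w}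

/-- `prec` is more delayed than `prec'`. -/
def MoreDelayed (prec prec' : V → V → Prop) : Prop :=
  (∀ k, (Vcum prec' k).ncard ≤ (Vcum prec k).ncard) ∧
  ∃ k, (Vcum prec' k).ncard < (Vcum prec k).ncard

/-- A maximally delayed Pauli flow: no Pauli flow for the same labelled open graph is
more delayed. -/
def IsMaxDelayed (Γ : LOG V) (p : V → Set V) (prec : V → V → Prop) : Prop :=
  IsPauliFlow Γ p prec ∧
  ∀ q prec', IsPauliFlow Γ q prec' → ¬ MoreDelayed prec' prec

/-- `Λ_u^P`: the measured vertices other than `u` whose label is `P`. -/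
def LamP (Γ : LOG V) (u : V) (P : MeasLabel) : Set V :=
  {v | v ∉ Γ.O ∧ v ≠ u ∧ Γ.lam v = P}

/-- `V_{k+1}^{≺,XY}` where `A = V_{∪k}^≺`. -/
def VXY (Γ : LOG V) (A : Set V) : Set V :=
  {u | u ∉ Γ.O ∧ Γ.lam u ∈ ({MeasLabel.XY, MeasLabel.X, MeasLabel.Y} : Set MeasLabel) ∧
    ∃ K, K ⊆ (A ∪ LamP Γ u MeasLabel.X ∪ LamP Γ u MeasLabel.Y) ∩ {v | v ∉ Γ.I} ∧
      (K ∩ LamP Γ u MeasLabel.Y) \ A = (odd Γ.G K ∩ LamP Γ u MeasLabel.Y) \ A ∧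
      odd Γ.G K \ (A ∪ LamP Γ u MeasLabel.Y ∪ LamP Γ u MeasLabel.Z) = {u}}

/-- `V_{k+1}^{≺,XZ}` where `A = V_{∪k}^≺`. -/
def VXZ (Γ : LOG V) (A : Set V) : Set V :=
  {u | u ∉ Γ.O ∧ Γ.lam u ∈ ({MeasLabel.XZ, MeasLabel.X, MeasLabel.Z} : Set MeasLabel) ∧
    ∃ K, K ⊆ (A ∪ LamP Γ u MeasLabel.X ∪ LamP Γ u MeasLabel.Y) ∩ {v | v ∉ Γ.I} ∧
      (K ∩ LamP Γ u MeasLabel.Y) \ A = (odd Γ.G (K ∪ {u}) ∩ LamP Γ u MeasLabel.Y) \ A ∧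
      odd Γ.G (K ∪ {u}) \ (A ∪ LamP Γ u MeasLabel.Y ∪ LamP Γ u MeasLabel.Z) = {u}}

/-- `V_{k+1}^{≺,YZ}` where `A = V_{∪k}^≺`. -/
def VYZ (Γ : LOG V) (A : Set V) : Set V :=
  {u | u ∉ Γ.O ∧ Γ.lam u ∈ ({MeasLabel.YZ, MeasLabel.Y, MeasLabel.Z} : Set MeasLabel) ∧
    ∃ K, K ⊆ (A ∪ LamP Γ u MeasLabel.X ∪ LamP Γ u MeasLabel.Y) ∩ {v | v ∉ Γ.I} ∧
      (K ∩ LamP Γ u MeasLabel.Y) \ A = (odd Γ.G (K ∪ {u}) ∩ LamP Γ u MeasLabel.Y) \ A ∧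
      odd Γ.G (K ∪ {u}) \ (A ∪ LamP Γ u MeasLabel.Y ∪ LamP Γ u MeasLabel.Z) = ∅}

end LOG


namespace FocAux
open LOG Classical

variable {V : Type} [Fintype V]

/-- Extension by zero of a vector indexed by the non-inputs. -/
noncomputable def ext (I : Set V) : ({v // v ∉ I} → ZMod 2) →ₗ[ZMod 2] (V → ZMod 2) where
  toFun f v := if h : v ∉ I then f ⟨v, h⟩ else 0
  map_add' f g := by
    funext v; by_cases h : v ∈ I <;> simp [h]
  map_smul' c f := by
    funext v; by_cases h : v ∈ I <;> simp [h]

/-- The neighbourhood sum. -/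
noncomputable def adj (G : SimpleGraph V) : (V → ZMod 2) →ₗ[ZMod 2] (V → ZMod 2) where
  toFun f w := ∑ u, if G.Adj w u then f u else 0
  map_add' f g := by
    funext w
    simp only [Pi.add_apply, ← Finset.sum_add_distrib]
    refine Finset.sum_congr rfl fun u _ => ?_
    split_ifs <;> simp
  map_smul' c f := by
    funext w
    simp only [Pi.smul_apply, smul_eq_mul, RingHom.id_apply, Finset.mul_sum]
    refine Finset.sum_congr rfl fun u _ => ?_
    split_ifs <;> simp

/-- Coefficient of the membership indicator. -/
def ca : MeasLabel → ZMod 2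
  | .XY => 0 | .X => 0 | .XZ => 1 | .YZ => 1 | .Z => 1 | .Y => 1

/-- Coefficient of the odd-neighbourhood indicator. -/
def cb : MeasLabel → ZMod 2
  | .XY => 1 | .X => 1 | .XZ => 0 | .YZ => 0 | .Z => 0 | .Y => 1

/-- The constraint map. -/
noncomputable def con (Γ : LOG V) :
    ({v // v ∉ Γ.I} → ZMod 2) →ₗ[ZMod 2] ({v // v ∉ Γ.O} → ZMod 2) where
  toFun f w := ca (Γ.lam w) * ext Γ.I f w + cb (Γ.lam w) * adj Γ.G (ext Γ.I f) w
  map_add' f g := by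
    funext w; simp only [map_add, Pi.add_apply]; ring
  map_smul' c f := by
    funext w; simp only [map_smul, Pi.smul_apply, smul_eq_mul, RingHom.id_apply]; ring

/-- The indicator vector. -/
noncomputable def ind (s : Set V) (v : V) : ZMod 2 := if v ∈ s then 1 else 0

/-- The indicator vector on the non-inputs. -/
noncomputable def vec (Γ : LOG V) (s : Set V) : {v // v ∉ Γ.I} → ZMod 2 := fun v => ind s v

lemma ext_vec (Γ : LOG V) (s : Set V) (hs : ∀ v ∈ s, v ∉ Γ.I) :
    ext Γ.I (vec Γ s) = ind s := by
  funext v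
  by_cases h : v ∈ Γ.I
  · have : v ∉ s := fun hv => hs v hv h
    simp [ext, ind, h, this]
  · simp [ext, vec, h]

lemma adj_ind (G : SimpleGraph V) (s : Set V) : adj G (ind s) = ind (odd G s) := by
  funext w
  have h1 : adj G (ind s) w = (((G.neighborSet w ∩ s).ncard : ℕ) : ZMod 2) := by
    rw [Set.ncard_eq_toFinset_card']
    simp only [adj, ind, LinearMap.coe_mk, AddHom.coe_mk, ← ite_and, Finset.sum_boole]
    congr 2
    ext u; simp
  rw [h1]
  by_cases h : w ∈ odd G s
  · have h' : Odd ((G.neighborSet w ∩ s).ncard) := h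
    simp only [ind, h, if_true]
    exact ZMod.natCast_eq_one_iff_odd.2 h'
  · have h' : ¬ Odd ((G.neighborSet w ∩ s).ncard) := h
    simp only [ind, h, if_false]
    exact ZMod.natCast_eq_zero_iff_even.2 (Nat.not_odd_iff_even.1 h')

lemma con_vec (Γ : LOG V) (s : Set V) (hs : ∀ v ∈ s, v ∉ Γ.I) (w : {v // v ∉ Γ.O}) :
    con Γ (vec Γ s) w = ca (Γ.lam w) * ind s w + cb (Γ.lam w) * ind (odd Γ.G s) w := by
  simp only [con, LinearMap.coe_mk, AddHom.coe_mk, ext_vec Γ s hs, adj_ind]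

lemma foc_iff (Γ : LOG V) (s S : Set V) :
    FocussedOver Γ s S ↔
      ∀ w ∈ S, ca (Γ.lam w) * ind s w + cb (Γ.lam w) * ind (odd Γ.G s) w = 0 := by
  have h2 : (1 + 1 : ZMod 2) = 0 := by decide
  have key : ∀ w, ca (Γ.lam w) * ind s w + cb (Γ.lam w) * ind (odd Γ.G s) w = 0 ↔
      (w ∈ s → Γ.lam w ∈ ({MeasLabel.XY, MeasLabel.X, MeasLabel.Y} : Set MeasLabel)) ∧
      (w ∈ odd Γ.G s →
        Γ.lam w ∈ ({MeasLabel.XZ, MeasLabel.YZ, MeasLabel.Y, MeasLabel.Z} : Set MeasLabel)) ∧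
      (Γ.lam w = MeasLabel.Y → (w ∈ s ↔ w ∈ odd Γ.G s)) := by
    intro w
    by_cases h : w ∈ s <;> by_cases h' : w ∈ odd Γ.G s <;>
      cases hl : Γ.lam w <;> simp [ca, cb, ind, h, h', h2]
  simp only [key]
  constructor
  · rintro ⟨a, b, c⟩ w hw
    exact ⟨fun h => a w ⟨hw, h⟩, fun h => b w ⟨hw, h⟩, c w hw⟩
  · intro H
    exact ⟨fun w h => (H w h.1).1 h.2, fun w h => (H w h.1).2.1 h.2, fun w h => (H w h).2.2⟩

lemma con_flow (Γ : LOG V) (p : V → Set V) (prec : V → V → Prop) (hp : IsPauliFlow Γ p prec)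
    (hf : IsFocussed Γ p) (v : {v // v ∉ Γ.O}) :
    con Γ (vec Γ (p v)) = Pi.single v 1 := by
  funext w
  rw [con_vec Γ _ (hp.psub v v.2)]
  by_cases hwv : w = v
  · subst hwv
    rw [Pi.single_eq_same]
    have h4 := hp.pf4 w w.2
    have h5 := hp.pf5 w w.2
    have h6 := hp.pf6 w w.2
    have h7 := hp.pf7 w w.2
    have h8 := hp.pf8 w w.2
    have h9 := hp.pf9 w w.2
    cases hl : Γ.lam w
    · simp [ca, cb, ind, h4 hl]
    · simp [ca, cb, ind, h5 hl]
    · simp [ca, cb, ind, h6 hl]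
    · simp [ca, cb, ind, h7 hl]
    · rcases h9 hl with h | h <;> simp [ca, cb, ind, h]
    · simp [ca, cb, ind, h8 hl]
  · rw [Pi.single_eq_of_ne hwv]
    exact (foc_iff Γ _ _).1 (hf v v.2) w ⟨w.2, fun h => hwv (Subtype.ext h)⟩

lemma con_surj (Γ : LOG V) (p : V → Set V) (prec : V → V → Prop) (hp : IsPauliFlow Γ p prec)
    (hf : IsFocussed Γ p) : Function.Surjective (con Γ) := by
  intro g
  refine ⟨∑ v, g v • vec Γ (p v), ?_⟩
  rw [map_sum]
  simp only [map_smul, con_flow Γ p prec hp hf]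
  funext w
  simp [Finset.sum_apply, Pi.single_apply]

lemma focset_iff (Γ : LOG V) (s : Set V) (hs : ∀ v ∈ s, v ∉ Γ.I) :
    IsFocussedSet Γ s ↔ con Γ (vec Γ s) = 0 := by
  rw [IsFocussedSet, foc_iff]
  constructor
  · rintro ⟨-, h⟩
    funext w
    rw [con_vec Γ s hs]
    exact h w w.2
  · intro h
    refine ⟨hs, fun w hw => ?_⟩
    have := congrFun h ⟨w, hw⟩
    rwa [con_vec Γ s hs] at this

lemma card_eq (Γ : LOG V) :
    {s : Set V | IsFocussedSet Γ s}.ncard = Nat.card (LinearMap.ker (con Γ)) := by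
  rw [← Nat.card_coe_set_eq]
  refine Nat.card_congr (Equiv.ofBijective
    (fun s => ⟨vec Γ s.1, (focset_iff Γ s.1 s.2.1).1 s.2⟩) ⟨?_, ?_⟩)
  · rintro ⟨s, hs⟩ ⟨t, ht⟩ h
    have h' : vec Γ s = vec Γ t := congrArg Subtype.val h
    have h3 : ind s = ind t := by rw [← ext_vec Γ s hs.1, ← ext_vec Γ t ht.1, h']
    apply Subtype.ext
    show s = t
    ext v
    have := congrFun h3 v
    by_cases a : v ∈ s <;> by_cases b : v ∈ t <;> simp_all [ind]
  · rintro ⟨f, hf⟩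
    have hs : ∀ v ∈ {v | ext Γ.I f v = 1}, v ∉ Γ.I := by
      intro v hv hI
      simp [ext, hI] at hv
    have hv : vec Γ {v | ext Γ.I f v = 1} = f := by
      funext v
      have h01 : ∀ x : ZMod 2, (if x = 1 then 1 else 0) = x := by decide
      have := h01 (f v)
      simpa [vec, ind, ext, v.2] using this
    refine ⟨⟨{v | ext Γ.I f v = 1}, (focset_iff Γ _ hs).2 ?_⟩, Subtype.ext hv⟩
    rw [hv]; exact hf

lemma fin_compl (S : Set V) : Module.finrank (ZMod 2) ({v // v ∉ S} → ZMod 2) + S.ncard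
    = Fintype.card V := by
  rw [Module.finrank_fintype_fun_eq_card, ← Nat.card_eq_fintype_card, ← Nat.card_eq_fintype_card,
    ← Set.ncard_add_ncard_compl S, add_comm]
  rfl

end FocAux

open LOG in
/-- a labelled open graph with a focussed Pauli flow satisfies
`|I| ≤ |O|` and has exactly `2 ^ (|O| - |I|)` focussed sets. -/
theorem card_focussed_sets {V : Type} [Fintype V] (Γ : LOG V)
    (h : ∃ p prec, IsPauliFlow Γ p prec ∧ IsFocussed Γ p) :
    Γ.I.ncard ≤ Γ.O.ncard ∧
      {s : Set V | IsFocussedSet Γ s}.ncard = 2 ^ (Γ.O.ncard - Γ.I.ncard) := by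
  obtain ⟨p, prec, hp, hf⟩ := h
  have hr := LinearMap.finrank_range_add_finrank_ker (FocAux.con Γ)
  rw [LinearMap.range_eq_top.2 (FocAux.con_surj Γ p prec hp hf), finrank_top] at hr
  have h1 := FocAux.fin_compl Γ.I
  have h2 := FocAux.fin_compl Γ.O
  refine ⟨by omega, ?_⟩
  rw [FocAux.card_eq, Module.natCard_eq_pow_finrank (K := ZMod 2), Nat.card_zmod]
  congr 1
  omega
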